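/- arXiv:2412.11626 — 3 statements merged into one kernel-verified Lean document; each statement's English description precedes it below -/
import Mathlib

section
/- Let ρ ∈ (0,1) and β ∈ ℝ. Set D = (1-2ρ)² + 4ρ(1-ρ)e^β, α̂ = 2ρ/(1+√D) and β̂ = 2(1-ρ)/(1+√D). Then α̂, β̂ ∈ (0,1), α̂/(α̂+β̂) = ρ, and α̂·β̂/((1-α̂)(1-β̂)) = e^{-β}. Moreover (α̂, β̂) is the unique pair in (0,1)×(0,1) satisfying these two equations. -/
theorem conditional_probabilities_characterization (ρ β : ℝ) (hρ : ρ ∈ Set.Ioo (0:ℝ) 1)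
    (D α β' : ℝ)
    (hD : D = (1 - 2*ρ)^2 + 4*ρ*(1-ρ)*Real.exp β)
    (hα : α = 2*ρ / (1 + Real.sqrt D))
    (hβ' : β' = 2*(1-ρ) / (1 + Real.sqrt D)) :
    α ∈ Set.Ioo (0:ℝ) 1 ∧ β' ∈ Set.Ioo (0:ℝ) 1 ∧
    α / (α + β') = ρ ∧
    α * β' / ((1 - α) * (1 - β')) = Real.exp (-β) ∧
    ∀ a b : ℝ, a ∈ Set.Ioo (0:ℝ) 1 → b ∈ Set.Ioo (0:ℝ) 1 →
      a / (a + b) = ρ → a * b / ((1 - a) * (1 - b)) = Real.exp (-β) →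
      a = α ∧ b = β' := by
  obtain ⟨h0, h1⟩ := hρ
  have hE : 0 < Real.exp β := Real.exp_pos β
  have hρρ : 0 < 4 * ρ * (1 - ρ) := mul_pos (by linarith) (by linarith)
  have hDlt : (1 - 2 * ρ) ^ 2 < D := by
    rw [hD]
    linarith [mul_pos hρρ hE]
  have hD0 : 0 ≤ D := (sq_nonneg _).trans hDlt.le
  have hsq : Real.sqrt D ^ 2 = D := Real.sq_sqrt hD0
  have habs : |1 - 2 * ρ| < Real.sqrt D := Real.lt_sqrt_of_sq_lt (by rwa [sq_abs])
  obtain ⟨hlo, hhi⟩ := abs_lt.mp habs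
  have hs0 : 0 ≤ Real.sqrt D := Real.sqrt_nonneg D
  rw [Real.exp_neg]
  set s := Real.sqrt D
  have hs : 0 < 1 + s := by linarith
  refine ⟨?_, ?_, ?_, ?_, ?_⟩
  · rw [hα]
    exact ⟨div_pos (by linarith) hs, (div_lt_one hs).mpr (by linarith)⟩
  · rw [hβ']
    exact ⟨div_pos (by linarith) hs, (div_lt_one hs).mpr (by linarith)⟩
  · have hsum : α + β' = 2 / (1 + s) := by
      rw [hα, hβ']
      ring
    rw [hsum, hα]
    field_simp
  · have hα1 : 1 - α = (1 + s - 2 * ρ) / (1 + s) := by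
      rw [hα]
      field_simp
    have hβ1 : 1 - β' = (s - 1 + 2 * ρ) / (1 + s) := by
      rw [hβ']
      field_simp
      ring
    have hprod : (1 - α) * (1 - β') = α * β' * Real.exp β := by
      rw [hα1, hβ1, hα, hβ']
      field_simp
      linear_combination hsq + hD
    have hαβ : α * β' ≠ 0 := by
      rw [hα, hβ']
      exact (mul_pos (div_pos (by linarith) hs) (div_pos (by linarith) hs)).ne'
    rw [hprod, div_mul_cancel_left₀ hαβ]
  · rintro a b ⟨ha0, ha1⟩ ⟨hb0, hb1⟩ hab hgibbs
    have ht : 0 < a + b := by linarith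
    have haρ : a = ρ * (a + b) := (div_eq_iff ht.ne').mp hab
    have hbρ : b = (1 - ρ) * (a + b) := by linarith
    have hne : (1 - a) * (1 - b) ≠ 0 := (mul_pos (by linarith) (by linarith)).ne'
    have hprod : a * b * Real.exp β = (1 - a) * (1 - b) := by
      rw [div_eq_iff hne] at hgibbs
      rw [hgibbs]
      field_simp
    have habt : a * b = ρ * (1 - ρ) * (a + b) ^ 2 := by
      calc a * b = (ρ * (a + b)) * ((1 - ρ) * (a + b)) := by rw [← haρ, ← hbρ]
        _ = _ := by ring
    have hquad : (s * (a + b)) ^ 2 = (2 - (a + b)) ^ 2 := by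
      rw [mul_pow, hsq, hD]
      linear_combination 4 * hprod - 4 * (Real.exp β - 1) * habt
    have hlin : s * (a + b) = 2 - (a + b) :=
      (sq_eq_sq₀ (mul_nonneg hs0 ht.le) (by linarith)).mp hquad
    constructor
    · rw [hα, eq_div_iff hs.ne']
      linear_combination (1 + s) * haρ + ρ * hlin
    · rw [hβ', eq_div_iff hs.ne']
      linear_combination (1 + s) * hbρ + (1 - ρ) * hlin
end

section
/- Let ρ ∈ (0,1) and β ∈ ℝ. Set D = (1-2ρ)² + 4ρ(1-ρ)e^β, α̂ = 2ρ/(1+√D), β̂ = 2(1-ρ)/(1+√D), and let T be the 2×2 real matrix with rows (1-α̂, α̂) and (β̂, 1-β̂). Then the series ∑_{j=1}^∞ (ρ·(T^j)(1,1) - ρ²) converges (where (T^j)(1,1) denotes the second-row second-column entry of T^j), and ρ(1-ρ) + 2·∑_{j=1}^∞ (ρ·(T^j)(1,1) - ρ²) = ρ(1-ρ)·√D. -/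
/-- Powers of the two-state transition matrix with stationary law `(1 - ρ, ρ)` and second
eigenvalue `r`. -/
theorem two_state_transition_pow (ρ r : ℝ) (n : ℕ) :
    (!![1 - ρ * (1 - r), ρ * (1 - r); (1 - ρ) * (1 - r), 1 - (1 - ρ) * (1 - r)] :
      Matrix (Fin 2) (Fin 2) ℝ) ^ n =
    !![1 - ρ * (1 - r ^ n), ρ * (1 - r ^ n);
      (1 - ρ) * (1 - r ^ n), 1 - (1 - ρ) * (1 - r ^ n)] := by
  induction n with
  | zero => simp [Matrix.one_fin_two]
  | succ n ih =>
    rw [pow_succ, ih, Matrix.mul_fin_two]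
    congr! 3 <;> ring_nf

theorem integrated_covariance_matrix_form (ρ β : ℝ) (hρ : ρ ∈ Set.Ioo (0:ℝ) 1)
    (D α β' : ℝ)
    (hD : D = (1 - 2*ρ)^2 + 4*ρ*(1-ρ)*Real.exp β)
    (hα : α = 2*ρ / (1 + Real.sqrt D))
    (hβ' : β' = 2*(1-ρ) / (1 + Real.sqrt D))
    (T : Matrix (Fin 2) (Fin 2) ℝ)
    (hT : T = !![1 - α, α; β', 1 - β']) :
    Summable (fun j : ℕ => ρ * (T ^ (j + 1)) 1 1 - ρ^2) ∧
    ρ * (1 - ρ) + 2 * ∑' j : ℕ, (ρ * (T ^ (j + 1)) 1 1 - ρ^2)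
      = ρ * (1 - ρ) * Real.sqrt D := by
  obtain ⟨h0, h1⟩ := hρ
  have h1' : 0 < 1 - ρ := sub_pos.2 h1
  have hs : 0 < Real.sqrt D := Real.sqrt_pos.2 (by rw [hD]; positivity)
  set s := Real.sqrt D
  set r := (s - 1) / (1 + s) with hr
  have hα_r : α = ρ * (1 - r) := by rw [hα, hr]; field_simp; ring
  have hβ_r : β' = (1 - ρ) * (1 - r) := by rw [hβ', hr]; field_simp; ring
  have hr_abs : |r| < 1 := by
    rw [abs_lt, hr, lt_div_iff₀ (by positivity), div_lt_one (by positivity)]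
    constructor <;> linarith
  have hterm (j : ℕ) : ρ * (T ^ (j + 1)) 1 1 - ρ ^ 2 = ρ * (1 - ρ) * r * r ^ j := by
    rw [hT, hα_r, hβ_r, two_state_transition_pow]
    simp only [Matrix.of_apply, Matrix.cons_val_one, Matrix.cons_val_fin_one]
    ring
  have hsum := (hasSum_geometric_of_abs_lt_one hr_abs).mul_left (ρ * (1 - ρ) * r)
  simp_rw [hterm]
  refine ⟨hsum.summable, ?_⟩
  have hinv : 1 - r = 2 / (1 + s) := by rw [hr]; field_simp; ring
  rw [hsum.tsum_eq, hinv, hr]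
  field_simp
  ring
end

section
/- Fix L > 0. For f ∈ C([-L,L]) define sargmax(f) = inf{ u ∈ [-L,L] : max_{x∈[-L,u]} f(x) = max_{x∈[-L,L]} f(x) }. Suppose f ∈ C([-L,L]) attains its maximum over [-L,L] at a unique point u* ∈ [-L,L]. Then: (i) sargmax(f) = u*; and (ii) for every sequence fₙ ∈ C([-L,L]) converging to f uniformly on [-L,L], sargmax(fₙ) → u*. -/
open Filter

/-- The leftmost-maximizer functional on `C([-L,L])`:
`sargmax L f = inf { u ∈ [-L,L] : max_{x∈[-L,u]} f = max_{x∈[-L,L]} f }`. -/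
noncomputable def sargmax (L : ℝ) (f : ℝ → ℝ) : ℝ :=
  sInf {u ∈ Set.Icc (-L) L |
    sSup (f '' Set.Icc (-L) u) = sSup (f '' Set.Icc (-L) L)}

/-- On a continuous function, `sargmax` is attained at a maximizer. -/
theorem sargmax_mem_and_isMaxOn {L : ℝ} (hL : 0 < L) {f : ℝ → ℝ}
    (hf : ContinuousOn f (Set.Icc (-L) L)) :
    sargmax L f ∈ Set.Icc (-L) L ∧ IsMaxOn f (Set.Icc (-L) L) (sargmax L f) := by
  have hne : (Set.Icc (-L) L).Nonempty := Set.nonempty_Icc.2 (by linarith)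
  obtain ⟨c, hc, hcmax⟩ := isCompact_Icc.exists_isMaxOn hne hf
  have hcompact : IsCompact (Set.Icc (-L) L ∩ f ⁻¹' {f c}) :=
    isCompact_Icc.of_isClosed_subset
      (hf.preimage_isClosed_of_isClosed isClosed_Icc isClosed_singleton) Set.inter_subset_left
  obtain ⟨m, ⟨hm, hmc⟩, hleast⟩ := hcompact.exists_isLeast ⟨c, hc, rfl⟩
  have hmc : f m = f c := hmc
  have hmmax : ∀ x ∈ Set.Icc (-L) L, f x ≤ f m := fun x hx => hmc ▸ hcmax hx
  have hsup : ∀ v ∈ Set.Icc m L, sSup (f '' Set.Icc (-L) v) = f m := fun v hv =>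
    IsGreatest.csSup_eq ⟨⟨m, ⟨hm.1, hv.1⟩, rfl⟩, by
      rintro _ ⟨x, hx, rfl⟩
      exact hmmax x ⟨hx.1, hx.2.trans hv.2⟩⟩
  have hset : {v ∈ Set.Icc (-L) L |
      sSup (f '' Set.Icc (-L) v) = sSup (f '' Set.Icc (-L) L)} = Set.Icc m L := by
    ext v
    constructor
    · rintro ⟨hv, heq⟩
      obtain ⟨x, hx, hxsup⟩ := isCompact_Icc.exists_sSup_image_eq (Set.nonempty_Icc.2 hv.1)
        (hf.mono (Set.Icc_subset_Icc_right hv.2))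
      have hxc : f x = f c := by rw [← hxsup, heq, hsup L ⟨hm.2, le_rfl⟩, hmc]
      exact ⟨(hleast ⟨⟨hx.1, hx.2.trans hv.2⟩, hxc⟩).trans hx.2, hv.2⟩
    · intro hv
      exact ⟨⟨hm.1.trans hv.1, hv.2⟩, by rw [hsup v hv, hsup L ⟨hm.2, le_rfl⟩]⟩
  have hsarg : sargmax L f = m := by rw [sargmax, hset, csInf_Icc hm.2]
  rw [hsarg]
  exact ⟨hm, hmmax⟩

/-- Maximizers of uniform approximations on a compact set converge to the unique maximizer. -/
theorem IsCompact.tendsto_of_isMaxOn_of_tendstoUniformlyOn {X ι : Type*} [TopologicalSpace X]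
    {l : Filter ι} {K : Set X} (hK : IsCompact K) {f : X → ℝ} (hf : ContinuousOn f K)
    {u : X} (hu : u ∈ K) (hmax : IsMaxOn f K u) (huniq : ∀ x ∈ K, f x = f u → x = u)
    {F : ι → X → ℝ} (hF : TendstoUniformlyOn F f l K)
    {x : ι → X} (hxK : ∀ i, x i ∈ K) (hx : ∀ i, IsMaxOn (F i) K (x i)) :
    Tendsto x l (nhds u) := by
  rw [tendsto_nhds]
  intro U hU huU
  rcases (K \ U).eq_empty_or_nonempty with hempty | hne
  · exact Eventually.of_forall fun i => Set.sdiff_eq_empty.1 hempty (hxK i)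
  obtain ⟨y, hy, hymax⟩ := (hK.diff hU).exists_isMaxOn hne (hf.mono Set.sdiff_subset)
  have hlt : f y < f u :=
    lt_of_le_of_ne (hmax hy.1) fun h => hy.2 (huniq y hy.1 h ▸ huU)
  filter_upwards [Metric.tendstoUniformlyOn_iff.1 hF ((f u - f y) / 2) (by linarith)] with i hi
  by_contra hxU
  have hxy : f (x i) ≤ f y := hymax ⟨hxK i, hxU⟩
  have hux : F i u ≤ F i (x i) := hx i hu
  have h₁ := abs_lt.1 (hi u hu)
  have h₂ := abs_lt.1 (hi (x i) (hxK i))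
  linarith [h₁.2, h₂.1]

theorem sargmax_continuity_at_unique_maximizer
    (L : ℝ) (hL : 0 < L) (f : ℝ → ℝ)
    (hf : ContinuousOn f (Set.Icc (-L) L))
    (u : ℝ) (hu : u ∈ Set.Icc (-L) L)
    (hmax : ∀ x ∈ Set.Icc (-L) L, f x ≤ f u)
    (huniq : ∀ x ∈ Set.Icc (-L) L, f x = f u → x = u) :
    sargmax L f = u ∧
    ∀ fn : ℕ → ℝ → ℝ, (∀ n, ContinuousOn (fn n) (Set.Icc (-L) L)) →
      TendstoUniformlyOn fn f atTop (Set.Icc (-L) L) →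
      Tendsto (fun n => sargmax L (fn n)) atTop (nhds u) := by
  obtain ⟨hmem, hargmax⟩ := sargmax_mem_and_isMaxOn hL hf
  refine ⟨huniq _ hmem (le_antisymm (hmax _ hmem) (hargmax hu)), fun fn hfn hlim => ?_⟩
  exact isCompact_Icc.tendsto_of_isMaxOn_of_tendstoUniformlyOn hf hu hmax huniq hlim
    (fun n => (sargmax_mem_and_isMaxOn hL (hfn n)).1)
    (fun n => (sargmax_mem_and_isMaxOn hL (hfn n)).2)
end
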